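/- Let p be a positive integer, q an integer coprime to p, and let d₁, d₂ be coprime positive integers. Then there exist integers k₁ and k₂ such that gcd(p·d₂, k₁) = 1, gcd(p·d₁, k₂) = 1, and k₂ ≡ q·k₁ (mod p). -/

import Mathlib

/-- Claim 10.3: for `p > 0`, `q` coprime to `p`, and coprime positive integers `d₁, d₂`,
there exist integers `k₁, k₂` with `gcd(p·d₂, k₁) = 1`, `gcd(p·d₁, k₂) = 1`, and
`k₂ ≡ q·k₁ (mod p)`. -/
theorem exists_k1_k2_congruence (p q d₁ d₂ : ℤ)
    (hp : 0 < p) (hd₁ : 0 < d₁) (hd₂ : 0 < d₂)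
    (hqp : Int.gcd q p = 1) (hd : Int.gcd d₁ d₂ = 1) :
    ∃ k₁ k₂ : ℤ, Int.gcd (p * d₂) k₁ = 1 ∧ Int.gcd (p * d₁) k₂ = 1 ∧
      k₂ ≡ q * k₁ [ZMOD p] := by
  lift p to ℕ using hp.le
  lift d₁ to ℕ using hd₁.le
  have hp' : p ≠ 0 := by rintro rfl; simp at hp
  have hd' : d₁ ≠ 0 := by rintro rfl; simp at hd₁
  haveI : NeZero (p * d₁) := ⟨mul_ne_zero hp' hd'⟩
  have hu : IsUnit (q : ZMod p) := by
    rw [ZMod.coe_int_isUnit_iff_isCoprime]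
    exact (Int.isCoprime_iff_gcd_eq_one.mpr hqp).symm
  obtain ⟨v, hv⟩ := ZMod.unitsMap_surjective (Dvd.intro d₁ rfl : p ∣ p * d₁) hu.unit
  obtain ⟨k, hk⟩ := ZMod.intCast_surjective (v : ZMod (p * d₁))
  refine ⟨1, k, by simp, ?_, ?_⟩
  · have h : IsUnit (k : ZMod (p * d₁)) := hk ▸ v.isUnit
    rw [ZMod.coe_int_isUnit_iff_isCoprime] at h
    rw [← Int.isCoprime_iff_gcd_eq_one]
    exact_mod_cast h
  · rw [← ZMod.intCast_eq_intCast_iff]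
    have h := congrArg Units.val hv
    rw [ZMod.unitsMap_def, Units.coe_map] at h
    simp only [IsUnit.unit_spec, MonoidHom.coe_coe, ← hk, map_intCast] at h
    simpa using h
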